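/- arXiv:0706.2647 — 2 statements merged into one kernel-verified Lean document; each statement's English description precedes it below -/
import Mathlib

section
/- Let (X, d_X, μ_X) and (Y, d_Y, μ_Y) be mm-spaces, λ ≥ 0, and for each n ∈ ℕ let ε_n > 0 and let f_n : X → Y be a Borel measurable map that is λ-Lipschitz up to ε_n. Assume ε_n → 0 as n → ∞ and that the sequence {(f_n)_*(μ_X)} of pushforward measures converges weakly to μ_Y. Then {f_n} has a subsequence that converges with respect to the distance me_1 (i.e., converges in measure) to some map X → Y. -/
open MeasureTheory Set Filter Topology

noncomputable section

/-- Lebesgue measure restricted to the interval `[0, m]`. -/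
def lebIcc (m : ℝ) : Measure ℝ := volume.restrict (Icc 0 m)

/-- `φ : [0,m] → X` is a parameter of the mm-space `(X, d_X, μX)`:
a Borel measurable map pushing Lebesgue measure on `[0,m]` forward to `μX`. -/
def IsParameter {X : Type*} [MeasurableSpace X] (μX : Measure X) (m : ℝ) (φ : ℝ → X) : Prop :=
  Measurable φ ∧ Measure.map φ (lebIcc m) = μX

/-- The pullback `φ*d_X` of the distance of `X` under `φ`. -/
def pb {X : Type*} [PseudoMetricSpace X] (φ : ℝ → X) : ℝ → ℝ → ℝ :=
  fun s t => dist (φ s) (φ t)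

/-- The distance `□_λ(d₁, d₂)` between two maps `d₁ d₂ : α × α → ℝ` over a finite
measure space `(α, μ)`. -/
def boxDist {α : Type*} [MeasurableSpace α] (μ : Measure α) (lam : ℝ)
    (d₁ d₂ : α → α → ℝ) : ℝ :=
  sInf {ε : ℝ | 0 < ε ∧ ∃ T : Set α, MeasurableSet T ∧
    (μ univ).toReal - lam * ε ≤ (μ T).toReal ∧
    ∀ x ∈ T, ∀ y ∈ T, |d₁ x y - d₂ x y| ≤ ε}

/-- `inf □_λ(φX*d_X, φY*d_Y)` over all parameters, for mm-spaces of equal total mass `m`. -/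
def boxInf {X Y : Type*} [PseudoMetricSpace X] [MeasurableSpace X]
    [PseudoMetricSpace Y] [MeasurableSpace Y] (lam m : ℝ)
    (μX : Measure X) (μY : Measure Y) : ℝ :=
  sInf {r : ℝ | ∃ (φX : ℝ → X) (φY : ℝ → Y), IsParameter μX m φX ∧ IsParameter μY m φY ∧
    r = boxDist (lebIcc m) lam (pb φX) (pb φY)}

open Classical in
/-- Gromov's box distance `□̲_λ(X, Y)` between mm-spaces. -/
def mmBox {X Y : Type*} [PseudoMetricSpace X] [MeasurableSpace X]
    [PseudoMetricSpace Y] [MeasurableSpace Y] (lam : ℝ)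
    (μX : Measure X) (μY : Measure Y) : ℝ :=
  if (μX univ).toReal = (μY univ).toReal then
    boxInf lam (μX univ).toReal μX μY
  else if (μX univ).toReal < (μY univ).toReal then
    boxInf lam (μX univ).toReal μX
      ((ENNReal.ofReal ((μX univ).toReal / (μY univ).toReal)) • μY)
      + ((μY univ).toReal - (μX univ).toReal)
  else
    boxInf lam (μY univ).toReal
      ((ENNReal.ofReal ((μY univ).toReal / (μX univ).toReal)) • μX) μY
      + ((μX univ).toReal - (μY univ).toReal)

/-- The measure `μ̲_r` on `r × r` real matrices: the pushforward of `μ^r` under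
`(x₁, …, x_r) ↦ (d(x_i, x_j))_{i,j}`, for a (pseudo)distance `d`. -/
def matMeasure {α : Type*} [MeasurableSpace α] (μ : Measure α) (d : α → α → ℝ) (r : ℕ) :
    Measure (Fin r → Fin r → ℝ) :=
  Measure.map (fun x : Fin r → α => fun i j => d (x i) (x j)) (Measure.pi fun _ : Fin r => μ)

/-- The support of a Borel measure. -/
def msupport {X : Type*} [TopologicalSpace X] [MeasurableSpace X] (μ : Measure X) : Set X :=
  {x | ∀ U : Set X, IsOpen U → x ∈ U → 0 < μ U}

/-- Two mm-spaces are isomorphic: there is a measure preserving isometry (bijective)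
between the supports of their measures. -/
def MMIsom {X Y : Type*} [MetricSpace X] [MeasurableSpace X] [MetricSpace Y] [MeasurableSpace Y]
    (μX : Measure X) (μY : Measure Y) : Prop :=
  ∃ f : msupport μX → msupport μY, Function.Bijective f ∧ Isometry f ∧
    Measure.map f (Measure.comap Subtype.val μX) = Measure.comap Subtype.val μY

/-- The distance `me_λ` on the space of all real valued functions on `(α, μ)`. -/
def meDist {α : Type*} [MeasurableSpace α] (μ : Measure α) (lam : ℝ) (f g : α → ℝ) : ℝ :=
  sInf {ε : ℝ | 0 < ε ∧ (μ {x | ε ≤ |f x - g x|}).toReal ≤ lam * ε}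

/-- The distance `me₁` for maps into a metric space. -/
def meDistMap {α Y : Type*} [MeasurableSpace α] [PseudoMetricSpace Y]
    (μ : Measure α) (f g : α → Y) : ℝ :=
  sInf {ε : ℝ | 0 < ε ∧ (μ {x | ε ≤ dist (f x) (g x)}).toReal ≤ ε}

/-- `Lip_1(d)`: the real valued functions that are `1`-Lipschitz w.r.t. a semi-distance `d`. -/
def Lip1 {α : Type*} (d : α → α → ℝ) : Set (α → ℝ) := {f | ∀ x y, |f x - f y| ≤ d x y}

/-- `d` is a semi-distance function. -/
structure IsSemiDist {α : Type*} (d : α → α → ℝ) : Prop where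
  refl : ∀ x, d x x = 0
  symm : ∀ x y, d x y = d y x
  triangle : ∀ x y z, d x z ≤ d x y + d y z

/-- `H_λLι₁(d, d')`: the Hausdorff distance between `Lip_1(d)` and `Lip_1(d')` in
`(𝓕(α, ℝ), me_λ)`. -/
def HL {α : Type*} [MeasurableSpace α] (μ : Measure α) (lam : ℝ) (d d' : α → α → ℝ) : ℝ :=
  sInf {ε : ℝ | 0 < ε ∧ (∀ f ∈ Lip1 d, ∃ g ∈ Lip1 d', meDist μ lam f g ≤ ε) ∧
    (∀ g ∈ Lip1 d', ∃ f ∈ Lip1 d, meDist μ lam f g ≤ ε)}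

/-- `inf H_λLι₁(φX*d_X, φY*d_Y)` over all parameters, for mm-spaces of equal total mass `m`. -/
def obsInf {X Y : Type*} [PseudoMetricSpace X] [MeasurableSpace X]
    [PseudoMetricSpace Y] [MeasurableSpace Y] (lam m : ℝ)
    (μX : Measure X) (μY : Measure Y) : ℝ :=
  sInf {r : ℝ | ∃ (φX : ℝ → X) (φY : ℝ → Y), IsParameter μX m φX ∧ IsParameter μY m φY ∧
    r = HL (lebIcc m) lam (pb φX) (pb φY)}

open Classical in
/-- Gromov's observable distance `H̲_λLι₁(X, Y)` between mm-spaces. -/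
def mmObs {X Y : Type*} [PseudoMetricSpace X] [MeasurableSpace X]
    [PseudoMetricSpace Y] [MeasurableSpace Y] (lam : ℝ)
    (μX : Measure X) (μY : Measure Y) : ℝ :=
  if (μX univ).toReal = (μY univ).toReal then
    obsInf lam (μX univ).toReal μX μY
  else if (μX univ).toReal < (μY univ).toReal then
    obsInf lam (μX univ).toReal μX
      ((ENNReal.ofReal ((μX univ).toReal / (μY univ).toReal)) • μY)
      + ((μY univ).toReal - (μX univ).toReal)
  else
    obsInf lam (μY univ).toReal
      ((ENNReal.ofReal ((μY univ).toReal / (μX univ).toReal)) • μX) μY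
      + ((μX univ).toReal - (μY univ).toReal)

/-- `f : X → Y` is `λ`-Lipschitz up to `ε`. -/
def LipUpTo {X Y : Type*} [PseudoMetricSpace X] [PseudoMetricSpace Y] [MeasurableSpace X]
    (μX : Measure X) (lam ε : ℝ) (f : X → Y) : Prop :=
  ∃ X₀ : Set X, MeasurableSet X₀ ∧ (μX X₀ᶜ).toReal ≤ ε ∧
    ∀ x ∈ X₀, ∀ x' ∈ X₀, dist (f x) (f x') ≤ lam * dist x x' + ε

/-- Weak convergence of a sequence of finite Borel measures: convergence of integrals of
all bounded continuous functions. -/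
def WeakConv {Y : Type*} [TopologicalSpace Y] [MeasurableSpace Y]
    (μs : ℕ → Measure Y) (μ : Measure Y) : Prop :=
  ∀ g : BoundedContinuousFunction Y ℝ,
    Tendsto (fun n => ∫ y, g y ∂(μs n)) atTop (𝓝 (∫ y, g y ∂μ))

/-- `X` Lipschitz dominates `Y`: there are a `1`-Lipschitz map `p : Supp μX → Supp μY` and
`c ≥ 1` with `p_*(μX) = c • μY`. -/
def LipDom {X Y : Type*} [MetricSpace X] [MeasurableSpace X] [MetricSpace Y] [MeasurableSpace Y]
    (μX : Measure X) (μY : Measure Y) : Prop :=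
  ∃ (p : msupport μX → msupport μY) (c : ℝ), 1 ≤ c ∧
    (∀ a b : msupport μX, dist (p a) (p b) ≤ dist a b) ∧
    Measure.map p (Measure.comap Subtype.val μX)
      = (ENNReal.ofReal c) • Measure.comap Subtype.val μY

end

/-- If `μs` converges weakly to `μ`, then up to mass less than `δ`, almost all of the `μs` are
concentrated on a common finite union of `r`-balls. -/
theorem WeakConv.exists_finite_eventually_measure_compl_lt {Y : Type*} [MetricSpace Y]
    [CompleteSpace Y] [TopologicalSpace.SeparableSpace Y] [MeasurableSpace Y] [BorelSpace Y]
    {μs : ℕ → Measure Y} {μ : Measure Y} [∀ n, IsFiniteMeasure (μs n)] [IsFiniteMeasure μ]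
    (h : WeakConv μs μ) {r : ℝ} (hr : 0 < r) {δ : ENNReal} (hδ : 0 < δ) :
    ∃ t : Set Y, t.Finite ∧ ∀ᶠ n in atTop, μs n (⋃ y ∈ t, Metric.ball y r)ᶜ < δ := by
  have := UniformSpace.secondCountable_of_separable Y
  obtain ⟨δ', hδ'0, hδ'⟩ := exists_between hδ
  obtain ⟨K, hK, hKμ⟩ := isTightMeasureSet_iff_exists_isCompact_measure_compl_le.1
    (isTightMeasureSet_singleton (μ := μ)) δ' hδ'0
  obtain ⟨t, -, ht, hKt⟩ := hK.finite_cover_balls hr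
  refine ⟨t, ht, ?_⟩
  let νs : ℕ → FiniteMeasure Y := fun n => ⟨μs n, inferInstance⟩
  let ν : FiniteMeasure Y := ⟨μ, inferInstance⟩
  have hlim : Tendsto νs atTop (𝓝 ν) :=
    FiniteMeasure.tendsto_iff_forall_integral_tendsto.2 h
  have hclosed : IsClosed (⋃ y ∈ t, Metric.ball y r)ᶜ :=
    (isOpen_biUnion fun _ _ => Metric.isOpen_ball).isClosed_compl
  refine eventually_lt_of_limsup_lt ?_
  calc _ ≤ μ (⋃ y ∈ t, Metric.ball y r)ᶜ :=
        FiniteMeasure.limsup_measure_closed_le_of_tendsto hlim hclosed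
    _ ≤ μ Kᶜ := measure_mono (compl_subset_compl.2 hKt)
    _ ≤ δ' := hKμ μ rfl
    _ < δ := hδ'

theorem totallyBounded_range_of_forall_exists_eventually {Y : Type*} [PseudoMetricSpace Y]
    {u : ℕ → Y}
    (h : ∀ δ > 0, ∃ t : Set Y, t.Finite ∧ ∀ᶠ n in atTop, u n ∈ ⋃ y ∈ t, Metric.ball y δ) :
    TotallyBounded (range u) := by
  refine Metric.totallyBounded_iff.2 fun δ hδ => ?_
  obtain ⟨t, ht, hu⟩ := h δ hδ
  obtain ⟨M, hM⟩ := eventually_atTop.1 hu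
  refine ⟨t ∪ u '' Iio M, ht.union ((finite_Iio M).image u), ?_⟩
  rintro _ ⟨n, rfl⟩
  rw [biUnion_union]
  rcases le_or_gt M n with hn | hn
  · exact Or.inl (hM n hn)
  · exact Or.inr (mem_biUnion (mem_image_of_mem u hn) (Metric.mem_ball_self hδ))

/-- At a point of `A` in the support of `μX|_A`, where the `f n` are eventually almost Lipschitz
on `A`, the sequence of values is totally bounded. -/
theorem totallyBounded_range_of_mem_support {X Y : Type*}
    [MetricSpace X] [MeasurableSpace X] [BorelSpace X]
    [MetricSpace Y] [CompleteSpace Y] [TopologicalSpace.SeparableSpace Y]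
    [MeasurableSpace Y] [BorelSpace Y]
    {μX : Measure X} {μY : Measure Y} [IsFiniteMeasure μX] [IsFiniteMeasure μY]
    {lam : ℝ} (hlam : 0 ≤ lam) {ε : ℕ → ℝ} {f : ℕ → X → Y} (hf : ∀ n, Measurable (f n))
    (hε0 : Tendsto ε atTop (𝓝 0)) (hweak : WeakConv (fun n => Measure.map (f n) μX) μY)
    {A : Set X}
    (hA : ∀ᶠ n in atTop, ∀ x ∈ A, ∀ x' ∈ A, dist (f n x) (f n x') ≤ lam * dist x x' + ε n)
    {x : X} (hxA : x ∈ A) (hx : x ∈ (μX.restrict A).support) :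
    TotallyBounded (range fun n => f n x) := by
  refine totallyBounded_range_of_forall_exists_eventually fun δ hδ => ?_
  have hr : 0 < δ / (3 * (lam + 1)) := by positivity
  have hpos := (Measure.mem_support_iff_forall x).1 hx _ (Metric.ball_mem_nhds x hr)
  rw [Measure.restrict_apply Metric.isOpen_ball.measurableSet] at hpos
  obtain ⟨t, ht, hμ⟩ := hweak.exists_finite_eventually_measure_compl_lt
    (show 0 < δ / 3 by positivity) hpos
  refine ⟨t, ht, ?_⟩
  filter_upwards [hμ, hA, hε0.eventually_lt_const (show 0 < δ / 3 by positivity)] with n hn hAn hεn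
  have hopen : IsOpen (⋃ y ∈ t, Metric.ball y (δ / 3)) :=
    isOpen_biUnion fun _ _ => Metric.isOpen_ball
  rw [Measure.map_apply (hf n) hopen.measurableSet.compl] at hn
  obtain ⟨z, ⟨hzx, hzA⟩, hz⟩ := not_subset.1 fun hsub => (measure_mono hsub).not_gt hn
  rw [preimage_compl, notMem_compl_iff, mem_preimage, mem_iUnion₂] at hz
  obtain ⟨y, hy, hzy⟩ := hz
  refine mem_biUnion hy ?_
  rw [Metric.mem_ball] at hzx hzy ⊢
  have h1 : lam * dist x z ≤ δ / 3 := by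
    rw [dist_comm] at hzx
    calc lam * dist x z ≤ (lam + 1) * (δ / (3 * (lam + 1))) := by gcongr; linarith
      _ = δ / 3 := by field_simp
  linarith [hAn x hxA z hzA, dist_triangle (f n x) (f n z) y]

/-- A sequence of points in a countable product of complete spaces whose coordinates have
totally bounded ranges has a coordinatewise convergent subsequence. -/
theorem exists_subseq_tendsto_of_totallyBounded {ι Y : Type*} [Countable ι] [MetricSpace Y]
    [CompleteSpace Y] (u : ℕ → ι → Y) (hu : ∀ i, TotallyBounded (range fun n => u n i)) :
    ∃ φ : ℕ → ℕ, StrictMono φ ∧ ∀ i, ∃ y, Tendsto (fun n => u (φ n) i) atTop (𝓝 y) := by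
  have hK : IsCompact (univ.pi fun i => closure (range fun n => u n i)) :=
    isCompact_univ_pi fun i => (hu i).closure.isCompact_of_isClosed isClosed_closure
  obtain ⟨a, -, φ, hφ, ha⟩ :=
    hK.tendsto_subseq (x := u) fun n i _ => subset_closure (mem_range_self n)
  exact ⟨φ, hφ, fun i => ⟨a i, tendsto_pi_nhds.1 ha i⟩⟩

/-- If the `f n` are almost Lipschitz on `A` and converge on a dense part of `A`, then they
converge on `A`. -/
theorem exists_tendsto_of_dense {X Y : Type*} [MetricSpace X] [MetricSpace Y] [CompleteSpace Y]
    {lam : ℝ} (hlam : 0 ≤ lam) {ε : ℕ → ℝ} {f : ℕ → X → Y} (hε0 : Tendsto ε atTop (𝓝 0))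
    {A D : Set X}
    (hA : ∀ᶠ n in atTop, ∀ x ∈ A, ∀ x' ∈ A, dist (f n x) (f n x') ≤ lam * dist x x' + ε n)
    (hDA : D ⊆ A) (hD : ∀ x ∈ D, ∃ y, Tendsto (fun n => f n x) atTop (𝓝 y))
    {x : X} (hxA : x ∈ A) (hxD : x ∈ closure D) :
    ∃ y, Tendsto (fun n => f n x) atTop (𝓝 y) := by
  refine cauchySeq_tendsto_of_complete (Metric.cauchySeq_iff'.2 fun δ hδ => ?_)
  obtain ⟨z, hzD, hz⟩ := Metric.mem_closure_iff.1 hxD (δ / (6 * (lam + 1))) (by positivity)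
  obtain ⟨y, hy⟩ := hD z hzD
  have h1 : lam * dist x z ≤ δ / 6 := by
    calc lam * dist x z ≤ (lam + 1) * (δ / (6 * (lam + 1))) := by gcongr; linarith
      _ = δ / 6 := by field_simp
  obtain ⟨N, hN⟩ := eventually_atTop.1 (hA.and
    ((hε0.eventually_lt_const (show 0 < δ / 6 by positivity)).and
      (Metric.tendsto_nhds.1 hy (δ / 6) (by positivity))))
  have key : ∀ n ≥ N, dist (f n x) y < δ / 2 := fun n hn => by
    obtain ⟨hAn, hεn, hyn⟩ := hN n hn
    linarith [hAn x hxA z (hDA hzD), dist_triangle (f n x) (f n z) y]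
  exact ⟨N, fun n hn => by
    linarith [key n hn, key N le_rfl, dist_triangle_right (f n x) (f N x) y]⟩

theorem tendsto_meDistMap_of_tendstoInMeasure {X Y : Type*} [MeasurableSpace X] [MetricSpace Y]
    {μ : Measure X} [IsFiniteMeasure μ] {f : ℕ → X → Y} {g : X → Y}
    (h : TendstoInMeasure μ f atTop g) :
    Tendsto (fun n => meDistMap μ (f n) g) atTop (𝓝 0) := by
  rw [tendstoInMeasure_iff_measureReal_dist] at h
  refine Metric.tendsto_nhds.2 fun δ hδ => ?_
  filter_upwards [(h (δ / 2) (by positivity)).eventually_lt_const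
    (show 0 < δ / 2 by positivity)] with n hn
  have h0 : 0 ≤ meDistMap μ (f n) g := Real.sInf_nonneg fun _ h => h.1.le
  have hle : meDistMap μ (f n) g ≤ δ / 2 := csInf_le ⟨0, fun _ h => h.1.le⟩ ⟨by positivity, hn.le⟩
  rw [Real.dist_eq, sub_zero, abs_of_nonneg h0]
  linarith

/-- When the errors `ε n` are bounded by `2⁻ⁿ`, some subsequence converges almost everywhere. -/
theorem exists_subseq_ae_tendsto_of_lipUpTo {X Y : Type*}
    [MetricSpace X] [TopologicalSpace.SeparableSpace X] [MeasurableSpace X] [BorelSpace X]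
    [MetricSpace Y] [CompleteSpace Y] [TopologicalSpace.SeparableSpace Y]
    [MeasurableSpace Y] [BorelSpace Y]
    {μX : Measure X} {μY : Measure Y} [IsFiniteMeasure μX] [IsFiniteMeasure μY]
    {lam : ℝ} (hlam : 0 ≤ lam) {ε : ℕ → ℝ} {f : ℕ → X → Y} (hf : ∀ n, Measurable (f n))
    (hlip : ∀ n, LipUpTo μX lam (ε n) (f n)) (hε0 : Tendsto ε atTop (𝓝 0))
    (hε : ∀ n, ε n ≤ (1 / 2) ^ n)
    (hweak : WeakConv (fun n => Measure.map (f n) μX) μY) :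
    ∃ φ : ℕ → ℕ, StrictMono φ ∧
      ∀ᵐ x ∂μX, ∃ y, Tendsto (fun n => f (φ n) x) atTop (𝓝 y) := by
  have := UniformSpace.secondCountable_of_separable X
  choose X₀ hX₀m hX₀μ hX₀ using hlip
  let A : ℕ → Set X := fun N => ⋂ n ≥ N, X₀ n
  have hAm : ∀ N, MeasurableSet (A N) := fun N =>
    MeasurableSet.iInter fun n => MeasurableSet.iInter fun _ => hX₀m n
  have hA : ∀ N, ∀ᶠ n in atTop, ∀ x ∈ A N, ∀ x' ∈ A N,
      dist (f n x) (f n x') ≤ lam * dist x x' + ε n := fun N => by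
    filter_upwards [eventually_ge_atTop N] with n hn x hx x' hx'
    exact hX₀ n x (mem_iInter₂.1 hx n hn) x' (mem_iInter₂.1 hx' n hn)
  have hBC : ∀ᵐ x ∂μX, ∃ N, x ∈ A N := by
    have hsum : ∑' n, μX (X₀ n)ᶜ ≠ ⊤ := by
      refine ne_top_of_le_ne_top summable_geometric_two.tsum_ofReal_ne_top
        (ENNReal.tsum_le_tsum fun n => ?_)
      rw [← ENNReal.ofReal_toReal (measure_ne_top μX (X₀ n)ᶜ)]
      exact ENNReal.ofReal_le_ofReal ((hX₀μ n).trans (hε n))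
    filter_upwards [ae_eventually_notMem hsum] with x hx
    obtain ⟨N, hN⟩ := eventually_atTop.1 hx
    exact ⟨N, mem_iInter₂.2 fun n hn => notMem_compl_iff.1 (hN n hn)⟩
  have hsupp : ∀ᵐ x ∂μX, ∀ N, x ∈ A N → x ∈ (μX.restrict (A N)).support :=
    ae_all_iff.2 fun N => (ae_restrict_iff' (hAm N)).1 Measure.support_mem_ae
  choose D hDS hDc hDd using fun N => (TopologicalSpace.IsSeparable.of_separableSpace
    (A N ∩ (μX.restrict (A N)).support)).exists_countable_dense_subset
  have : Countable (⋃ N, D N) := (countable_iUnion hDc).to_subtype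
  obtain ⟨φ, hφ, hconv⟩ := exists_subseq_tendsto_of_totallyBounded
    (fun n (x : ⋃ N, D N) => f n x) fun ⟨x, hx⟩ => by
      obtain ⟨N, hN⟩ := mem_iUnion.1 hx
      exact totallyBounded_range_of_mem_support hlam hf hε0 hweak (hA N) (hDS N hN).1 (hDS N hN).2
  refine ⟨φ, hφ, ?_⟩
  filter_upwards [hBC, hsupp] with x ⟨N, hN⟩ hx
  exact exists_tendsto_of_dense (f := fun n => f (φ n)) hlam (hε0.comp hφ.tendsto_atTop)
    (hφ.tendsto_atTop.eventually (hA N)) (fun z hz => (hDS N hz).1)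
    (fun z hz => hconv ⟨z, mem_iUnion.2 ⟨N, hz⟩⟩) hN (hDd N ⟨hN, hx N hN⟩)

/-- a sequence of Borel maps, `λ`-Lipschitz up to `ε_n` with `ε_n → 0`,
whose pushforwards converge weakly to `μY`, has a `me₁`-convergent subsequence. -/
theorem lipUpTo_me_convergent_subsequence {X Y : Type*}
    [MetricSpace X] [CompleteSpace X] [TopologicalSpace.SeparableSpace X]
    [MeasurableSpace X] [BorelSpace X]
    [MetricSpace Y] [CompleteSpace Y] [TopologicalSpace.SeparableSpace Y]
    [MeasurableSpace Y] [BorelSpace Y]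
    (μX : Measure X) (μY : Measure Y) [IsFiniteMeasure μX] [IsFiniteMeasure μY]
    (lam : ℝ) (hlam : 0 ≤ lam) (ε : ℕ → ℝ) (hε : ∀ n, 0 < ε n)
    (f : ℕ → X → Y) (hf : ∀ n, Measurable (f n))
    (hlip : ∀ n, LipUpTo μX lam (ε n) (f n))
    (hε0 : Tendsto ε atTop (𝓝 0))
    (hweak : WeakConv (fun n => Measure.map (f n) μX) μY) :
    ∃ ψ : ℕ → ℕ, StrictMono ψ ∧ ∃ g : X → Y,
      Tendsto (fun n => meDistMap μX (f (ψ n)) g) atTop (𝓝 0) := by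
  have := UniformSpace.secondCountable_of_separable Y
  obtain ⟨φ, hφ, hεφ⟩ := extraction_forall_of_eventually'
    (P := fun n k => ε k ≤ (1 / 2) ^ n) fun n =>
      (hε0.eventually_le_const (show (0 : ℝ) < (1 / 2) ^ n by positivity)).exists_forall_of_atTop
  obtain ⟨χ, hχ, hconv⟩ := exists_subseq_ae_tendsto_of_lipUpTo hlam (fun n => hf (φ n))
    (fun n => hlip (φ n)) (hε0.comp hφ.tendsto_atTop) hεφ
    (fun g => (hweak g).comp hφ.tendsto_atTop)
  have hlim : ∀ x, ∃ y, (∃ y', Tendsto (fun n => f (φ (χ n)) x) atTop (𝓝 y')) →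
      Tendsto (fun n => f (φ (χ n)) x) atTop (𝓝 y) := fun x => by
    by_cases h : ∃ y', Tendsto (fun n => f (φ (χ n)) x) atTop (𝓝 y')
    · exact h.imp fun _ hy _ => hy
    · exact ⟨f 0 x, fun h' => absurd h' h⟩
  choose g hg using hlim
  refine ⟨φ ∘ χ, hφ.comp hχ, g, tendsto_meDistMap_of_tendstoInMeasure
    (tendstoInMeasure_of_tendsto_ae (fun n => (hf _).aestronglyMeasurable) ?_)⟩
  filter_upwards [hconv] with x hx using hg x hx
end

section
/- Let {μ_n} be a sequence of finite Borel measures on a complete separable metric space (X, d_X) that converges weakly to a finite Borel measure μ on X. Then □̲_1((X, d_X, μ_n), (X, d_X, μ)) → 0 as n → ∞. -/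
open MeasureTheory Set Filter Topology

theorem sum_smul_restrict_le {X ι : Type*} [MeasurableSpace X] (α : Measure X)
    (s : Finset ι) {G : ι → Set X} (hG : ∀ i, MeasurableSet (G i))
    (hd : Pairwise (Function.onFun Disjoint G)) {c : ι → ENNReal} (hc : ∀ i, c i ≤ 1) :
    ∑ i ∈ s, c i • α.restrict (G i) ≤ α := by
  refine Measure.le_iff.2 fun t ht => ?_
  simp only [Measure.coe_finsetSum, Finset.sum_apply, Measure.smul_apply, smul_eq_mul]
  calc ∑ i ∈ s, c i * α.restrict (G i) t
      ≤ ∑ i ∈ s, α (t ∩ G i) := by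
        refine Finset.sum_le_sum fun i _ => ?_
        rw [Measure.restrict_apply ht]
        exact mul_le_of_le_one_left' (hc i)
    _ = α (⋃ i ∈ s, t ∩ G i) := by
        refine (measure_biUnion_finset (fun i _ j _ hij => ?_) fun i _ => ht.inter (hG i)).symm
        exact (hd hij).mono inter_subset_right inter_subset_right
    _ ≤ α t := measure_mono (by simp)

/-- Two measures of equal mass are coupled so that all their common mass on the disjoint sets `G i`
is carried by the squares `G i ×ˢ G i`. -/
theorem exists_coupling {X ι : Type*} [MeasurableSpace X] (α β : Measure X)
    [IsFiniteMeasure α] [IsFiniteMeasure β] (hαβ : α univ = β univ)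
    (s : Finset ι) {G : ι → Set X} (hG : ∀ i, MeasurableSet (G i))
    (hd : Pairwise (Function.onFun Disjoint G)) :
    ∃ π : Measure (X × X), π.map Prod.fst = α ∧ π.map Prod.snd = β ∧
      π (⋃ i ∈ s, G i ×ˢ G i)ᶜ ≤ α univ - ∑ i ∈ s, min (α (G i)) (β (G i)) := by
  set c : ι → ENNReal := fun i => (max (α (G i)) (β (G i)))⁻¹
  set ρ : Measure (X × X) := ∑ i ∈ s, c i • (α.restrict (G i)).prod (β.restrict (G i))
  have hfst : ρ.map Prod.fst = ∑ i ∈ s, (c i * β (G i)) • α.restrict (G i) := by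
    rw [Measure.map_finset_sum (by fun_prop)]
    refine Finset.sum_congr rfl fun i _ => ?_
    rw [Measure.map_smul, Measure.map_fst_prod, Measure.restrict_apply_univ, smul_smul]
  have hsnd : ρ.map Prod.snd = ∑ i ∈ s, (c i * α (G i)) • β.restrict (G i) := by
    rw [Measure.map_finset_sum (by fun_prop)]
    refine Finset.sum_congr rfl fun i _ => ?_
    rw [Measure.map_smul, Measure.map_snd_prod, Measure.restrict_apply_univ, smul_smul]
  have hfst_le : ρ.map Prod.fst ≤ α := by
    rw [hfst]
    exact sum_smul_restrict_le α s hG hd fun i =>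
      (mul_le_mul_right (le_max_right _ _) _).trans (ENNReal.inv_mul_le_one _)
  have hsnd_le : ρ.map Prod.snd ≤ β := by
    rw [hsnd]
    exact sum_smul_restrict_le β s hG hd fun i =>
      (mul_le_mul_right (le_max_left _ _) _).trans (ENNReal.inv_mul_le_one _)
  have : IsFiniteMeasure (ρ.map Prod.fst) := isFiniteMeasure_of_le α hfst_le
  have : IsFiniteMeasure (ρ.map Prod.snd) := isFiniteMeasure_of_le β hsnd_le
  have hρ : ρ univ = ∑ i ∈ s, min (α (G i)) (β (G i)) := by
    simp only [ρ, Measure.coe_finsetSum, Finset.sum_apply, Measure.smul_apply, smul_eq_mul]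
    refine Finset.sum_congr rfl fun i _ => ?_
    rw [← univ_prod_univ, Measure.prod_prod, Measure.restrict_apply_univ,
      Measure.restrict_apply_univ, ← max_mul_min (α (G i)), ← mul_assoc]
    by_cases h0 : max (α (G i)) (β (G i)) = 0
    · have := (min_le_max (a := α (G i)) (b := β (G i))).trans h0.le
      simp_all
    · rw [ENNReal.inv_mul_cancel h0 (by simp), one_mul]
  set r := α univ - ∑ i ∈ s, min (α (G i)) (β (G i))
  have hα : (α - ρ.map Prod.fst) univ = r := by
    rw [Measure.sub_apply .univ hfst_le, Measure.map_apply measurable_fst .univ, preimage_univ, hρ]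
  have hβ : (β - ρ.map Prod.snd) univ = r := by
    rw [Measure.sub_apply .univ hsnd_le, Measure.map_apply measurable_snd .univ, preimage_univ, hρ,
      ← hαβ]
  have hr : r ≠ ⊤ := ENNReal.sub_ne_top (measure_ne_top _ _)
  have hcancel : ∀ ν : Measure X, ν univ = r → r⁻¹ • r • ν = ν := fun ν hν => by
    by_cases h0 : r = 0
    · rw [Measure.measure_univ_eq_zero.1 (hν.trans h0)]; simp
    · rw [smul_smul, ENNReal.inv_mul_cancel h0 hr, one_smul]
  refine ⟨ρ + r⁻¹ • (α - ρ.map Prod.fst).prod (β - ρ.map Prod.snd), ?_, ?_, ?_⟩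
  · rw [Measure.map_add _ _ measurable_fst, Measure.map_smul, Measure.map_fst_prod, hβ,
      hcancel _ hα, add_comm, Measure.sub_add_cancel_of_le hfst_le]
  · rw [Measure.map_add _ _ measurable_snd, Measure.map_smul, Measure.map_snd_prod, hα,
      hcancel _ hβ, add_comm, Measure.sub_add_cancel_of_le hsnd_le]
  · have hzero : ρ (⋃ i ∈ s, G i ×ˢ G i)ᶜ = 0 := by
      simp only [ρ, Measure.coe_finsetSum, Finset.sum_apply, Measure.smul_apply, smul_eq_mul]
      refine Finset.sum_eq_zero fun i hi => ?_
      rw [Measure.prod_restrict]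
      refine mul_eq_zero_of_right _ (measure_mono_null (compl_subset_compl.2
        (subset_biUnion_of_mem (u := fun i => G i ×ˢ G i) hi)) ?_)
      rw [Measure.restrict_apply ((hG i).prod (hG i)).compl, compl_inter_self, measure_empty]
    calc _ = (r⁻¹ • (α - ρ.map Prod.fst).prod (β - ρ.map Prod.snd))
          (⋃ i ∈ s, G i ×ˢ G i)ᶜ := by rw [Measure.add_apply, hzero, zero_add]
      _ ≤ (r⁻¹ • (α - ρ.map Prod.fst).prod (β - ρ.map Prod.snd)) univ := measure_mono (subset_univ _)
      _ = r⁻¹ * r * r := by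
        rw [Measure.smul_apply, ← univ_prod_univ, Measure.prod_prod, hα, hβ, smul_eq_mul, mul_assoc]
      _ ≤ r := mul_le_of_le_one_left' (ENNReal.inv_mul_le_one _)

/-- Every finite measure on a nonempty standard Borel space has a parameter. -/
theorem exists_isParameter {Z : Type*} [MeasurableSpace Z] [StandardBorelSpace Z] [Nonempty Z]
    (π : Measure Z) [IsFiniteMeasure π] : ∃ φ, IsParameter π (π univ).toReal φ := by
  obtain rfl | hπ := eq_or_ne π 0
  · exact ⟨fun _ => Classical.arbitrary Z, measurable_const, by simp [lebIcc]⟩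
  have : NeZero π := ⟨hπ⟩
  have hpos : 0 < (π univ).toReal := measureReal_univ_pos
  obtain ⟨f, hf, hfπ⟩ := ((π univ)⁻¹ • π).exists_measurable_map_eq
  set m := (π univ).toReal
  have hm : π univ = ENNReal.ofReal m := (ENNReal.ofReal_toReal (measure_ne_top _ _)).symm
  have hproj : Measurable (projIcc (0 : ℝ) 1 zero_le_one) := continuous_projIcc.measurable
  have hscale : (lebIcc m).map (fun t => t / m) = ENNReal.ofReal m • lebIcc 1 := by
    have : Icc (0 : ℝ) m = (fun t => t / m) ⁻¹' Icc 0 1 := by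
      ext t; simp [div_le_one hpos, le_div_iff₀ hpos]
    rw [lebIcc, lebIcc, this, ← Measure.restrict_map (by fun_prop) measurableSet_Icc]
    simp_rw [div_eq_mul_inv]
    rw [Real.map_volume_mul_right (inv_ne_zero hpos.ne'), inv_inv, abs_of_pos hpos,
      Measure.restrict_smul]
  have hunit : (lebIcc 1).map (projIcc (0 : ℝ) 1 zero_le_one) = volume := by
    rw [lebIcc, ← map_comap_subtype_coe measurableSet_Icc, Measure.map_map hproj (by fun_prop)]
    have : projIcc (0 : ℝ) 1 zero_le_one ∘ Subtype.val = id := by ext x; simp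
    rw [this, Measure.map_id]
    rfl
  refine ⟨fun t => f (projIcc 0 1 zero_le_one (t / m)), by fun_prop, ?_⟩
  have h1 : (fun t => f (projIcc 0 1 zero_le_one (t / m))) =
    f ∘ projIcc 0 1 zero_le_one ∘ fun t => t / m := rfl
  rw [h1, ← Measure.map_map hf (by fun_prop), ← Measure.map_map hproj (by fun_prop), hscale,
    Measure.map_smul, hunit, Measure.map_smul, hfπ, smul_smul, ← hm,
    ENNReal.mul_inv_cancel (Measure.measure_univ_ne_zero.2 hπ) (measure_ne_top _ _), one_smul]

theorem boxDist_nonneg {α : Type*} [MeasurableSpace α] (μ : Measure α) (lam : ℝ)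
    (d₁ d₂ : α → α → ℝ) : 0 ≤ boxDist μ lam d₁ d₂ :=
  Real.sInf_nonneg fun _ h => h.1.le

section

variable {X Y : Type*} [PseudoMetricSpace X] [MeasurableSpace X]
  [PseudoMetricSpace Y] [MeasurableSpace Y]

theorem boxInf_nonneg (lam m : ℝ) (μX : Measure X) (μY : Measure Y) :
    0 ≤ boxInf lam m μX μY := by
  refine Real.sInf_nonneg ?_
  rintro _ ⟨φ, ψ, -, -, rfl⟩
  exact boxDist_nonneg ..

/-- The three branches in the definition of the box distance agree with a single formula, in which
both measures are rescaled to the smaller of the two masses. -/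
theorem mmBox_eq (lam : ℝ) (μX : Measure X) (μY : Measure Y)
    [IsFiniteMeasure μX] [IsFiniteMeasure μY] :
    mmBox lam μX μY = boxInf lam (min (μX.real univ) (μY.real univ))
      (ENNReal.ofReal (min (μX.real univ) (μY.real univ) / μX.real univ) • μX)
      (ENNReal.ofReal (min (μX.real univ) (μY.real univ) / μY.real univ) • μY)
      + |μX.real univ - μY.real univ| := by
  have hX : ENNReal.ofReal (μX.real univ / μX.real univ) • μX = μX := by
    obtain rfl | h := eq_or_ne μX 0
    · simp
    · have : NeZero μX := ⟨h⟩
      rw [div_self measureReal_univ_pos.ne', ENNReal.ofReal_one, one_smul]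
  have hY : ENNReal.ofReal (μY.real univ / μY.real univ) • μY = μY := by
    obtain rfl | h := eq_or_ne μY 0
    · simp
    · have : NeZero μY := ⟨h⟩
      rw [div_self measureReal_univ_pos.ne', ENNReal.ofReal_one, one_smul]
  unfold mmBox
  split_ifs with h1 h2 <;> simp only [← measureReal_def] at *
  · rw [← h1] at hY ⊢
    rw [min_self, hX, hY, sub_self, abs_zero, add_zero]
  · rw [min_eq_left h2.le, hX, abs_of_neg (by linarith), neg_sub]
  · rw [min_eq_right (by linarith), hY, abs_of_nonneg (by linarith)]

theorem mmBox_nonneg (lam : ℝ) (μX : Measure X) (μY : Measure Y)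
    [IsFiniteMeasure μX] [IsFiniteMeasure μY] : 0 ≤ mmBox lam μX μY := by
  rw [mmBox_eq]
  exact add_nonneg (boxInf_nonneg ..) (abs_nonneg _)

end

theorem boxInf_le_of_coupling {X : Type*} [PseudoMetricSpace X] [MeasurableSpace X]
    [OpensMeasurableSpace X] [SecondCountableTopology X] [StandardBorelSpace X] [Nonempty X]
    {α β : Measure X} (π : Measure (X × X)) [IsFiniteMeasure π]
    (hα : π.map Prod.fst = α) (hβ : π.map Prod.snd = β) {ε : ℝ} (hε : 0 < ε)
    (hπ : π.real {p | ε / 2 < dist p.1 p.2} ≤ ε) :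
    boxInf 1 (π.real univ) α β ≤ ε := by
  obtain ⟨φ, hφ, hφπ⟩ := exists_isParameter π
  rw [← measureReal_def] at hφπ
  have hbdd : BddBelow {r : ℝ | ∃ (φX φY : ℝ → X), IsParameter α (π.real univ) φX ∧
      IsParameter β (π.real univ) φY ∧
      r = boxDist (lebIcc (π.real univ)) 1 (pb φX) (pb φY)} := by
    refine ⟨0, ?_⟩
    rintro _ ⟨_, _, -, -, rfl⟩
    exact boxDist_nonneg ..
  refine (csInf_le hbdd ⟨Prod.fst ∘ φ, Prod.snd ∘ φ, ⟨by fun_prop, ?_⟩, ⟨by fun_prop, ?_⟩,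
    rfl⟩).trans ?_
  · rw [← Measure.map_map measurable_fst hφ, hφπ, hα]
  · rw [← Measure.map_map measurable_snd hφ, hφπ, hβ]
  have hS : MeasurableSet {p : X × X | ε / 2 < dist p.1 p.2} :=
    measurableSet_lt measurable_const (by fun_prop)
  refine csInf_le ⟨0, fun _ h => h.1.le⟩
    ⟨hε, φ ⁻¹' {p | ε / 2 < dist p.1 p.2}ᶜ, hφ hS.compl, ?_, fun x hx y hy => ?_⟩
  · rw [← Measure.map_apply hφ hS.compl, ← preimage_univ (f := φ), ← Measure.map_apply hφ .univ,
      hφπ, ← measureReal_def, ← measureReal_def, measureReal_compl hS]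
    linarith
  · simp only [mem_preimage, mem_compl_iff, mem_ofPred_eq, not_lt] at hx hy
    have h1 := dist_dist_dist_le (φ x).1 (φ y).1 (φ x).2 (φ y).2
    rw [Real.dist_eq] at h1
    exact h1.trans (by linarith)

/-- Up to a null set, a separable space is the union of disjoint small open sets. -/
theorem exists_disjoint_isOpen_small {X : Type*} [PseudoMetricSpace X]
    [TopologicalSpace.SeparableSpace X] [MeasurableSpace X] [OpensMeasurableSpace X] [Nonempty X]
    (μ : Measure X) [SFinite μ] {ε : ℝ} (hε : 0 < ε) :
    ∃ G : ℕ → Set X, (∀ i, IsOpen (G i)) ∧ Pairwise (Function.onFun Disjoint G) ∧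
      (∀ i, ∀ x ∈ G i, ∀ y ∈ G i, dist x y ≤ ε) ∧ μ (⋃ i, G i)ᶜ = 0 := by
  choose r hr hr0 using fun i : ℕ => exists_null_frontier_thickening μ
    {TopologicalSpace.denseSeq X i} (show ε / 4 < ε / 2 by linarith)
  simp only [Metric.thickening_singleton] at hr0
  set B : ℕ → Set X := fun i => Metric.ball (TopologicalSpace.denseSeq X i) (r i)
  have hdisj : ∀ i j, i < j →
      Disjoint (B i \ ⋃ k ∈ Finset.range i, closure (B k))
        (B j \ ⋃ k ∈ Finset.range j, closure (B k)) := fun i j hij =>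
    Set.disjoint_left.2 fun x hi hj => hj.2 <|
      mem_biUnion (by simpa using hij) (subset_closure hi.1)
  refine ⟨fun i => B i \ ⋃ j ∈ Finset.range i, closure (B j), fun i => ?_, fun i j hij => ?_,
    fun i x hx y hy => ?_, ?_⟩
  · exact Metric.isOpen_ball.sdiff (isClosed_biUnion_finset fun _ _ => isClosed_closure)
  · rcases lt_or_gt_of_ne hij with h | h
    exacts [hdisj i j h, (hdisj j i h).symm]
  · have hx := Metric.mem_ball.1 hx.1
    have hy := Metric.mem_ball.1 hy.1
    linarith [dist_triangle_right x y (TopologicalSpace.denseSeq X i), (hr i).2]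
  · refine measure_mono_null (fun x hx => ?_) (measure_iUnion_null hr0)
    have hex : ∃ i, x ∈ B i := by
      obtain ⟨i, hi⟩ := (TopologicalSpace.denseRange_denseSeq X).exists_dist_lt x
        (show 0 < ε / 4 by linarith)
      exact ⟨i, hi.trans (hr i).1⟩
    classical
    by_contra hfr
    simp only [mem_iUnion, not_exists] at hfr
    refine hx (mem_iUnion.2 ⟨Nat.find hex, Nat.find_spec hex, ?_⟩)
    simp only [mem_iUnion, not_exists]
    intro j hj hcl
    refine hfr j ⟨hcl, fun hint => Nat.find_min hex (Finset.mem_range.1 hj) (interior_subset hint)⟩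

theorem WeakConv.tendsto_measureReal_univ {X : Type*} [TopologicalSpace X] [MeasurableSpace X]
    {μn : ℕ → Measure X} {μ : Measure X} (h : WeakConv μn μ) :
    Tendsto (fun n => (μn n).real univ) atTop (𝓝 (μ.real univ)) := by
  simpa using h (BoundedContinuousFunction.const X 1)

theorem WeakConv.eventually_lt_measureReal {X : Type*} [TopologicalSpace X]
    [HasOuterApproxClosed X] [MeasurableSpace X] [OpensMeasurableSpace X]
    {μn : ℕ → Measure X} {μ : Measure X} [∀ n, IsFiniteMeasure (μn n)] [IsFiniteMeasure μ]
    (h : WeakConv μn μ) {G : Set X} (hG : IsOpen G) {δ : ℝ} (hδ : 0 < δ) :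
    ∀ᶠ n in atTop, μ.real G - δ < (μn n).real G := by
  let ν : ℕ → FiniteMeasure X := fun n => ⟨μn n, inferInstance⟩
  let ν₀ : FiniteMeasure X := ⟨μ, inferInstance⟩
  have hν : Tendsto ν atTop (𝓝 ν₀) := FiniteMeasure.tendsto_iff_forall_integral_tendsto.2 h
  have hlim : limsup (fun n => μn n Gᶜ) atTop ≤ μ Gᶜ :=
    FiniteMeasure.limsup_measure_closed_le_of_tendsto hν hG.isClosed_compl
  have hlt : μ Gᶜ < ENNReal.ofReal (μ.real Gᶜ + δ / 2) := by
    rw [ENNReal.lt_ofReal_iff_toReal_lt (measure_ne_top _ _), ← measureReal_def]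
    linarith
  filter_upwards [eventually_lt_of_limsup_lt (hlim.trans_lt hlt),
    h.tendsto_measureReal_univ.eventually (lt_mem_nhds (sub_lt_self _ (half_pos hδ)))] with n h1 h2
  rw [ENNReal.lt_ofReal_iff_toReal_lt (measure_ne_top _ _), ← measureReal_def] at h1
  rw [measureReal_compl hG.measurableSet, measureReal_compl hG.measurableSet] at h1
  linarith

/-- weak convergence of measures on a fixed complete separable metric
space implies `□̲₁`-convergence of the corresponding mm-spaces. -/
theorem weakConv_implies_box_conv {X : Type*}
    [MetricSpace X] [CompleteSpace X] [TopologicalSpace.SeparableSpace X]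
    [MeasurableSpace X] [BorelSpace X]
    (μn : ℕ → Measure X) (μ : Measure X)
    [∀ n, IsFiniteMeasure (μn n)] [IsFiniteMeasure μ]
    (hweak : WeakConv μn μ) :
    Tendsto (fun n => mmBox 1 (μn n) μ) atTop (𝓝 0) := by
  have hmass : Tendsto (fun n => |(μn n).real univ - μ.real univ|) atTop (𝓝 0) := by
    simpa using (hweak.tendsto_measureReal_univ.sub_const (μ.real univ)).abs
  suffices hbox : ∀ ε > 0, ∀ᶠ n in atTop,
      mmBox 1 (μn n) μ ≤ ε + |(μn n).real univ - μ.real univ| by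
    refine Metric.tendsto_nhds.2 fun ε hε => ?_
    filter_upwards [hbox (ε / 2) (half_pos hε), hmass.eventually (gt_mem_nhds (half_pos hε))]
      with n h1 h2
    rw [Real.dist_0_eq_abs, abs_of_nonneg (mmBox_nonneg ..)]
    linarith
  intro ε hε
  obtain hX | hX := isEmpty_or_nonempty X
  · have hempty : ∀ m (α β : Measure X), boxInf 1 m α β = 0 := fun m α β => by
      unfold boxInf
      convert Real.sInf_empty
      exact eq_empty_of_forall_notMem fun _ ⟨φ, _⟩ => hX.elim (φ 0)
    refine .of_forall fun n => ?_
    rw [mmBox_eq, hempty]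
    linarith
  have := UniformSpace.secondCountable_of_separable X
  obtain ⟨G, hGo, hGd, hGε, hG0⟩ := exists_disjoint_isOpen_small μ (half_pos hε)
  obtain ⟨N, hN⟩ : ∃ N : ℕ, μ.real univ - ε / 2 < ∑ i ∈ Finset.range N, μ.real (G i) := by
    have hsum : HasSum (fun i => μ.real (G i)) (μ.real univ) := by
      have h1 : ∑' i, μ (G i) = μ univ := by
        rw [← measure_iUnion hGd fun i => (hGo i).measurableSet]
        exact measure_of_measure_compl_eq_zero hG0
      have hne : ∑' i, μ (G i) ≠ ⊤ := h1.trans_ne (measure_ne_top _ _)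
      rw [measureReal_def, ← h1, ENNReal.tsum_toReal_eq fun i => measure_ne_top _ _]
      exact ENNReal.hasSum_toReal hne
    exact (hsum.tendsto_sum_nat.eventually (lt_mem_nhds (by linarith))).exists
  have hη : 0 < ε / (4 * (N + 1)) := by positivity
  filter_upwards [hmass.eventually (gt_mem_nhds hη), (Finset.range N).eventually_all.2 fun i _ =>
    hweak.eventually_lt_measureReal (hGo i) hη] with n hn hGn
  rw [mmBox_eq]
  gcongr
  set a := (μn n).real univ
  set b := μ.real univ
  set M := min a b
  have hM : 0 ≤ M := le_min measureReal_nonneg measureReal_nonneg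
  have hab : max a b - M = |a - b| := max_sub_min_eq_abs' ..
  have hscale : ∀ ν : Measure X, ∀ [IsFiniteMeasure ν], M ≤ ν.real univ →
      (ENNReal.ofReal (M / ν.real univ) • ν) univ = ENNReal.ofReal M ∧
      ∀ s, ν.real s - (ν.real univ - M) ≤ (ENNReal.ofReal (M / ν.real univ) • ν).real s := by
    intro ν _ hν
    have hmul : M / ν.real univ * ν.real univ = M :=
      div_mul_cancel_of_imp fun h => le_antisymm (hν.trans h.le) hM
    have hle : M / ν.real univ ≤ 1 := div_le_one_of_le₀ hν measureReal_nonneg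
    have hnonneg : 0 ≤ M / ν.real univ := div_nonneg hM measureReal_nonneg
    refine ⟨?_, fun s => ?_⟩
    · rw [Measure.smul_apply, smul_eq_mul, ← ofReal_measureReal (measure_ne_top ν univ),
        ← ENNReal.ofReal_mul hnonneg, hmul]
    · rw [measureReal_ennreal_smul_apply, ENNReal.toReal_ofReal hnonneg]
      have hs : ν.real s ≤ ν.real univ := measureReal_mono (subset_univ s)
      nlinarith [mul_le_mul_of_nonneg_left hs (sub_nonneg.2 hle)]
  obtain ⟨hα, hαs⟩ := hscale (μn n) (min_le_left _ _)
  obtain ⟨hβ, hβs⟩ := hscale μ (min_le_right _ _)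
  set α := ENNReal.ofReal (M / (μn n).real univ) • μn n
  set β := ENNReal.ofReal (M / μ.real univ) • μ
  have : IsFiniteMeasure α := ⟨hα ▸ ENNReal.ofReal_lt_top⟩
  have : IsFiniteMeasure β := ⟨hβ ▸ ENNReal.ofReal_lt_top⟩
  obtain ⟨π, hπα, hπβ, hπ⟩ := exists_coupling α β (hα.trans hβ.symm) (Finset.range N)
    (fun i => (hGo i).measurableSet) hGd
  have hπM : π univ = ENNReal.ofReal M := by
    rw [← hα, ← hπα, Measure.map_apply measurable_fst .univ, preimage_univ]
  have : IsFiniteMeasure π := ⟨hπM ▸ ENNReal.ofReal_lt_top⟩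
  have hπreal : π.real univ = M := by rw [measureReal_def, hπM, ENNReal.toReal_ofReal hM]
  rw [← hπreal]
  refine boxInf_le_of_coupling π hπα hπβ hε (ENNReal.toReal_le_of_le_ofReal hε.le ?_)
  have hsub : {p : X × X | ε / 2 < dist p.1 p.2} ⊆
      (⋃ i ∈ Finset.range N, G i ×ˢ G i)ᶜ := fun p hp hmem => by
    simp only [mem_iUnion] at hmem
    obtain ⟨i, -, h1, h2⟩ := hmem
    exact (hGε i _ h1 _ h2).not_gt hp
  refine (measure_mono hsub).trans (hπ.trans (tsub_le_iff_left.2 ?_))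
  have hmin : ∀ i, min (α (G i)) (β (G i)) =
      ENNReal.ofReal (min (α.real (G i)) (β.real (G i))) := fun i => by
    rw [ENNReal.ofReal_min, ofReal_measureReal, ofReal_measureReal]
  simp_rw [hmin]
  rw [hα, ← ENNReal.ofReal_sum_of_nonneg fun i _ => le_min measureReal_nonneg measureReal_nonneg,
    ← ENNReal.ofReal_add (Finset.sum_nonneg fun i _ =>
      le_min measureReal_nonneg measureReal_nonneg) hε.le]
  refine ENNReal.ofReal_le_ofReal ?_
  have hterm : ∀ i ∈ Finset.range N, μ.real (G i) - 2 * (ε / (4 * (N + 1))) ≤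
      min (α.real (G i)) (β.real (G i)) := fun i hi => by
    have h1 := hαs (G i)
    have h2 := hβs (G i)
    have h3 := hGn i hi
    have h4 : a ≤ max a b := le_max_left _ _
    have h5 : b ≤ max a b := le_max_right _ _
    exact le_min (by linarith) (by linarith)
  have hsum := Finset.sum_le_sum hterm
  rw [Finset.sum_sub_distrib, Finset.sum_const, Finset.card_range, nsmul_eq_mul] at hsum
  have hNη : N * (2 * (ε / (4 * (N + 1)))) ≤ ε / 2 := by
    have h : (N : ℝ) / (N + 1) ≤ 1 := div_le_one_of_le₀ (by linarith) (by positivity)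
    calc N * (2 * (ε / (4 * (N + 1)))) = ε / 2 * (N / (N + 1)) := by field_simp; norm_num
      _ ≤ ε / 2 := mul_le_of_le_one_right (half_pos hε).le h
  have hMb : M ≤ b := min_le_right _ _
  linarith
end
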